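/- Let (𝒫, 𝒩) be a Beurling generalized number system with well-behaved integers, i.e. N(x) = Ax + O(x^θ) for some A > 0 and θ ∈ [0,1). Then for each positive integer j there exists a constant c_j > 0 such that ∑_{n_k ≤ x} d(n_k)^j ∼ c_j x (log x)^{2^j − 1} as x → ∞, where d is the generalized divisor function. -/

import Mathlib

open Filter Topology

/-- A Beurling generalized prime number system: a nondecreasing sequence of
generalized primes, each `> 1`, tending to infinity. -/
structure BeurlingSystem where
  p : ℕ → ℝ
  one_lt_p : ∀ k, 1 < p k
  p_mono : Monotone p
  p_tendsto : Filter.Tendsto p Filter.atTop Filter.atTop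

namespace BeurlingSystem

variable (S : BeurlingSystem)

/-- The numerical value of a generalized integer, encoded as the finitely supported
vector of exponents of the generalized primes. -/
noncomputable def val (n : ℕ →₀ ℕ) : ℝ := n.prod fun k e => S.p k ^ e

/-- The integer counting function `N(x)`. -/
noncomputable def cnt (x : ℝ) : ℝ := (Set.ncard {n : ℕ →₀ ℕ | S.val n ≤ x} : ℝ)

/-- `χ(x, λ)`: the number of generalized integers within distance `λ` of `x`. -/
noncomputable def chi (x lam : ℝ) : ℝ := (Set.ncard {n : ℕ →₀ ℕ | |x - S.val n| ≤ lam} : ℝ)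

/-- The integers are `θ`-well-behaved with density `A` and implied constant `K₀`:
`N(x) = A x + O(x^θ)`. -/
def WellBehaved (A θ K₀ : ℝ) : Prop :=
  0 < A ∧ 0 ≤ θ ∧ θ < 1 ∧ 0 ≤ K₀ ∧ ∀ x : ℝ, 1 ≤ x → |S.cnt x - A * x| ≤ K₀ * x ^ θ

/-- `ζ` is (the unique) analytic continuation of the Beurling zeta function
to `{Re s > θ} \ {1}`. -/
def IsZeta (θ : ℝ) (ζ : ℂ → ℂ) : Prop :=
  DifferentiableOn ℂ ζ {s : ℂ | θ < s.re ∧ s ≠ 1} ∧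
  ∀ s : ℂ, 1 < s.re → ζ s = ∑' n : ℕ →₀ ℕ, (S.val n : ℂ) ^ (-s)

/-- The von Mangoldt function: `log p` on prime powers `p^m`, `0` otherwise. -/
noncomputable def vonMangoldt (n : ℕ →₀ ℕ) : ℝ :=
  ∑ k ∈ n.support, if n.support = {k} then Real.log (S.p k) else 0

/-- The Chebyshev function `ψ(x)`. -/
noncomputable def psi (x : ℝ) : ℝ :=
  ∑ᶠ n ∈ {n : ℕ →₀ ℕ | S.val n ≤ x}, S.vonMangoldt n

end BeurlingSystem

/-- The generalized divisor function: the number of ordered pairs of generalized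
integers whose formal product equals `n`. -/
noncomputable def gDivisor (n : ℕ →₀ ℕ) : ℝ :=
  (Set.ncard {q : (ℕ →₀ ℕ) × (ℕ →₀ ℕ) | q.1 + q.2 = n} : ℝ)

/-- The generalized Möbius function. -/
noncomputable def gMoebius (n : ℕ →₀ ℕ) : ℝ :=
  if ∀ k ∈ n.support, n k ≤ 1 then (-1 : ℝ) ^ n.support.card else 0

/-- The zero-counting function `N(α, T)` of the (continued) zeta function. -/
noncomputable def zeroCount (ζ : ℂ → ℂ) (α T : ℝ) : ℝ :=
  (Set.ncard {ρ : ℂ | ζ ρ = 0 ∧ ρ ≠ 1 ∧ α ≤ ρ.re ∧ |ρ.im| ≤ T} : ℝ)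

/-! ### Local Euler factors -/

namespace PowerSeries

/-- The power series `∑ (m + 1)^j X^m`, the local factor of the `j`-th power of the
divisor function. -/
noncomputable def succPow (j : ℕ) : PowerSeries ℝ := mk fun m => ((m : ℝ) + 1) ^ j

theorem succPow_succ (j : ℕ) :
    succPow (j + 1) = succPow j + X * derivative ℝ (succPow j) := by
  ext m
  rcases m with _ | m
  · rw [map_add, coeff_zero_X_mul]
    simp [succPow]
  · rw [map_add, coeff_succ_X_mul, coeff_derivative]
    simp only [succPow, coeff_mk]
    push_cast
    ring

theorem succPow_zero_mul : succPow 0 * (1 - X) = 1 := by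
  have h : succPow 0 = mk 1 := by
    ext m
    simp [succPow]
  rw [h, mk_one_mul_one_sub_eq_one]

/-- The Eulerian polynomials: numerators of `∑ (m + 1)^j X^m`. -/
theorem exists_eulerian (j : ℕ) :
    ∃ P : Polynomial ℝ, (∀ m, 0 ≤ P.coeff m) ∧ (∀ m, j < m → P.coeff m = 0) ∧
      (P : PowerSeries ℝ) = succPow j * (1 - X) ^ (j + 1) := by
  induction j with
  | zero =>
    refine ⟨1, fun m => ?_, fun m hm => ?_, ?_⟩
    · rw [Polynomial.coeff_one]; split_ifs <;> norm_num
    · rw [Polynomial.coeff_one, if_neg (by omega)]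
    · simp [succPow_zero_mul]
  | succ j ih =>
    obtain ⟨P, hP0, hPj, hP⟩ := ih
    let R : Polynomial ℝ := (1 + (j : Polynomial ℝ) * Polynomial.X) * P
      + Polynomial.X * (1 - Polynomial.X) * Polynomial.derivative P
    have hR0 : R.coeff 0 = P.coeff 0 := by
      simp [R, Polynomial.mul_coeff_zero]
    have hR : ∀ m, R.coeff (m + 1) = ((m : ℝ) + 2) * P.coeff (m + 1)
        + ((j : ℝ) - m) * P.coeff m := by
      intro m
      have h1 : R = P + (j : ℝ) • (Polynomial.X * P) + Polynomial.X * Polynomial.derivative P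
          - Polynomial.X * (Polynomial.X * Polynomial.derivative P) := by
        simp only [R, Polynomial.smul_eq_C_mul, map_natCast]
        ring
      rw [h1]
      rcases m with _ | m
      · simp only [Polynomial.coeff_sub, Polynomial.coeff_add, Polynomial.coeff_smul,
          Polynomial.coeff_X_mul, Polynomial.coeff_derivative, smul_eq_mul]
        simp
        ring
      · simp only [Polynomial.coeff_sub, Polynomial.coeff_add, Polynomial.coeff_smul,
          Polynomial.coeff_X_mul, Polynomial.coeff_derivative, smul_eq_mul]
        push_cast
        ring
    refine ⟨R, fun m => ?_, fun m hm => ?_, ?_⟩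
    · rcases m with _ | m
      · rw [hR0]; exact hP0 0
      · rw [hR]
        rcases le_or_gt m j with h | h
        · have : (m : ℝ) ≤ j := by exact_mod_cast h
          exact add_nonneg (mul_nonneg (by positivity) (hP0 _))
            (mul_nonneg (by linarith) (hP0 _))
        · rw [hPj m h, hPj (m + 1) (by omega)]; simp
    · obtain ⟨m, rfl⟩ : ∃ k, m = k + 1 := ⟨m - 1, by omega⟩
      rw [hR, hPj m (by omega), hPj (m + 1) (by omega)]; simp
    · have hd : derivative ℝ (P : PowerSeries ℝ) * (1 - X) =
          derivative ℝ (succPow j) * (1 - X) ^ (j + 2) - ((j : ℝ) + 1) • (P : PowerSeries ℝ) := by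
        rw [hP, Derivation.leibniz, derivative_pow]
        simp only [map_sub, map_one, derivative_X, smul_eq_mul, Derivation.map_one_eq_zero,
          Nat.add_sub_cancel, smul_eq_C_mul, map_add, map_natCast]
        push_cast
        ring
      have hR' : (R : PowerSeries ℝ) = (1 + (j : PowerSeries ℝ) * X) * (P : PowerSeries ℝ)
          + X * (derivative ℝ (P : PowerSeries ℝ) * (1 - X)) := by
        simp only [R, Polynomial.coe_add, Polynomial.coe_mul, Polynomial.coe_sub,
          Polynomial.coe_one, Polynomial.coe_X, derivative_coe]
        have : (((j : Polynomial ℝ) : Polynomial ℝ) : PowerSeries ℝ) = (j : PowerSeries ℝ) := by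
          rw [← map_natCast (Polynomial.C : ℝ →+* Polynomial ℝ), Polynomial.coe_C, map_natCast]
        rw [this]
        ring
      rw [hR', hd, succPow_succ, smul_eq_C_mul]
      simp only [map_add, map_natCast, map_one]
      rw [hP]
      ring

/-- The local factor of the quotient of `d^j` by the `2^j`-fold divisor function is a polynomial
`1 + O(X^2)` that is positive on `[0, 1)`. -/
theorem exists_quotient_polynomial (j : ℕ) :
    ∃ Q : Polynomial ℝ, Q.coeff 0 = 1 ∧ Q.coeff 1 = 0 ∧ (∀ u : ℝ, 0 ≤ u → u < 1 → 0 < Q.eval u) ∧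
      succPow j = Q * succPow 0 ^ (2 ^ j) := by
  obtain ⟨P, hP0, -, hP⟩ := exists_eulerian j
  have hlt : j + 1 ≤ 2 ^ j := Nat.lt_two_pow_self
  let Q : Polynomial ℝ := (1 - Polynomial.X) ^ (2 ^ j - (j + 1)) * P
  have hQ : (Q : PowerSeries ℝ) = succPow j * (1 - X) ^ (2 ^ j) := by
    simp only [Q, Polynomial.coe_mul, Polynomial.coe_pow, Polynomial.coe_sub, Polynomial.coe_one,
      Polynomial.coe_X, hP]
    rw [mul_left_comm, ← pow_add, Nat.sub_add_cancel hlt]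
  have hP00 : P.coeff 0 = 1 := by
    rw [← Polynomial.coeff_coe, hP, coeff_zero_eq_constantCoeff_apply]
    simp [succPow]
  have h1X : ∀ n : ℕ, coeff 0 ((1 - X : PowerSeries ℝ) ^ n) = 1
      ∧ coeff 1 ((1 - X : PowerSeries ℝ) ^ n) = -n := by
    intro n
    induction n with
    | zero => simp [coeff_one]
    | succ n ih =>
      rw [pow_succ, mul_sub, mul_one, map_sub, map_sub, coeff_zero_mul_X, coeff_succ_mul_X,
        ih.1, ih.2]
      push_cast
      constructor <;> ring
  refine ⟨Q, ?_, ?_, ?_, ?_⟩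
  · rw [← Polynomial.coeff_coe, hQ, coeff_zero_eq_constantCoeff_apply]
    simp [succPow]
  · rw [← Polynomial.coeff_coe, hQ, coeff_mul, Finset.Nat.antidiagonal_succ]
    simp only [Finset.Nat.antidiagonal_zero, Finset.map_singleton, Finset.sum_cons,
      Finset.sum_singleton, Function.Embedding.prodMap]
    simp [h1X, succPow]
    norm_num
  · intro u hu0 hu1
    simp only [Q, Polynomial.eval_mul, Polynomial.eval_pow, Polynomial.eval_sub,
      Polynomial.eval_one, Polynomial.eval_X]
    refine mul_pos (pow_pos (by linarith) _) ?_
    rw [Polynomial.eval_eq_sum_range, Finset.sum_range_succ']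
    simp only [hP00, pow_zero, mul_one]
    have : 0 ≤ ∑ k ∈ Finset.range P.natDegree, P.coeff (k + 1) * u ^ (k + 1) :=
      Finset.sum_nonneg fun k _ => mul_nonneg (hP0 _) (by positivity)
    linarith
  · rw [hQ, mul_assoc, ← mul_pow, mul_comm (1 - X), succPow_zero_mul, one_pow, mul_one]

end PowerSeries

/-! ### Multiplicative functions on generalized integers -/

/-- The multiplicative function on exponent vectors whose local factors are all given by `φ`. -/
noncomputable def eulerSeries (φ : PowerSeries ℝ) : MvPowerSeries ℕ ℝ :=
  fun n => n.prod fun _ m => PowerSeries.coeff m φ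

theorem coeff_eulerSeries (φ : PowerSeries ℝ) (n : ℕ →₀ ℕ) :
    MvPowerSeries.coeff n (eulerSeries φ) = n.prod fun _ m => PowerSeries.coeff m φ := rfl

theorem sum_finsupp_prod (s : Finset ℕ) (t : ℕ → Finset ℕ) (f : ℕ → ℕ → ℝ) (hf : ∀ i, f i 0 = 1) :
    ∑ n ∈ s.finsupp t, n.prod f = ∏ i ∈ s, ∑ m ∈ t i, f i m := by
  classical
  rw [Finset.prod_sum, Finset.finsupp, Finset.sum_map]
  refine Finset.sum_congr (by congr!) fun p _ => ?_
  rw [Function.Embedding.coeFn_mk,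
    Finsupp.prod_of_support_subset _ (Finsupp.support_indicator_subset s p) _ fun i _ => hf i,
    ← Finset.prod_attach]
  refine Finset.prod_congr rfl fun i _ => ?_
  rw [Finsupp.indicator_of_mem i.2]

theorem eulerSeries_mul (φ ψ : PowerSeries ℝ) (hφ : PowerSeries.coeff 0 φ = 1)
    (hψ : PowerSeries.coeff 0 ψ = 1) :
    eulerSeries (φ * ψ) = eulerSeries φ * eulerSeries ψ := by
  classical
  ext n
  rw [MvPowerSeries.coeff_mul]
  simp only [coeff_eulerSeries]
  rw [Finsupp.prod]
  simp only [PowerSeries.coeff_mul]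
  rw [Finset.prod_sum]
  symm
  refine Finset.sum_nbij' (fun q i _ => (q.1 i, q.2 i))
    (fun p => (Finsupp.indicator n.support fun i hi => (p i hi).1,
      Finsupp.indicator n.support fun i hi => (p i hi).2)) ?_ ?_ ?_ ?_ ?_
  · intro q hq
    rw [Finset.HasAntidiagonal.mem_antidiagonal] at hq
    simp only [Finset.mem_pi, Finset.HasAntidiagonal.mem_antidiagonal]
    intro i _
    rw [← hq, Finsupp.add_apply]
  · intro p hp
    simp only [Finset.mem_pi, Finset.HasAntidiagonal.mem_antidiagonal] at hp
    rw [Finset.HasAntidiagonal.mem_antidiagonal]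
    ext i
    by_cases hi : i ∈ n.support
    · simpa [Finsupp.indicator_of_mem hi] using hp i hi
    · simp [Finsupp.indicator_of_notMem hi, Finsupp.notMem_support_iff.1 hi]
  · intro q hq
    rw [Finset.HasAntidiagonal.mem_antidiagonal] at hq
    refine Prod.ext ?_ ?_
    all_goals
      ext i
      by_cases hi : i ∈ n.support
      · simp [Finsupp.indicator_of_mem hi]
      · have h0 := Finsupp.notMem_support_iff.1 hi
        rw [← hq, Finsupp.add_apply] at h0
        simp only [Finsupp.indicator_of_notMem hi]
        omega
  · intro p hp
    funext i hi
    simp [Finsupp.indicator_of_mem hi]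
  · intro q hq
    rw [Finset.HasAntidiagonal.mem_antidiagonal] at hq
    have h1 : q.1.support ⊆ n.support := fun i hi => by
      rw [Finsupp.mem_support_iff] at hi ⊢
      rw [← hq, Finsupp.add_apply]; omega
    have h2 : q.2.support ⊆ n.support := fun i hi => by
      rw [Finsupp.mem_support_iff] at hi ⊢
      rw [← hq, Finsupp.add_apply]; omega
    rw [Finsupp.prod_of_support_subset _ h1 _ fun _ _ => hφ,
      Finsupp.prod_of_support_subset _ h2 _ fun _ _ => hψ, ← Finset.prod_mul_distrib,
      ← Finset.prod_attach]

theorem eulerSeries_one : eulerSeries 1 = 1 := by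
  classical
  ext n
  rw [coeff_eulerSeries, MvPowerSeries.coeff_one]
  split_ifs with h
  · simp [h]
  · obtain ⟨i, hi⟩ := Finsupp.support_nonempty_iff.2 h
    exact Finset.prod_eq_zero hi
      ((PowerSeries.coeff_one _).trans (if_neg (Finsupp.mem_support_iff.1 hi)))

theorem eulerSeries_pow (φ : PowerSeries ℝ) (hφ : PowerSeries.coeff 0 φ = 1) (k : ℕ) :
    eulerSeries (φ ^ k) = eulerSeries φ ^ k := by
  have hk : ∀ k : ℕ, PowerSeries.coeff 0 (φ ^ k) = 1 := fun k => by
    rw [PowerSeries.coeff_zero_eq_constantCoeff_apply] at hφ ⊢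
    rw [map_pow, hφ, one_pow]
  induction k with
  | zero => rw [pow_zero, pow_zero, eulerSeries_one]
  | succ k ih => rw [pow_succ, pow_succ, eulerSeries_mul _ _ (hk k) hφ, ih]

theorem gDivisor_eq_prod (n : ℕ →₀ ℕ) : gDivisor n = n.prod fun _ m => (m : ℝ) + 1 := by
  classical
  have h1 : gDivisor n = MvPowerSeries.coeff n
      (eulerSeries (PowerSeries.succPow 0) * eulerSeries (PowerSeries.succPow 0)) := by
    rw [MvPowerSeries.coeff_mul]
    simp only [coeff_eulerSeries, PowerSeries.succPow, PowerSeries.coeff_mk, pow_zero,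
      Finsupp.prod, Finset.prod_const_one, mul_one, Finset.sum_const, nsmul_eq_mul]
    rw [gDivisor, ← Set.ncard_coe_finset]
    congr 2
    ext q
    simp
  rw [h1, ← eulerSeries_mul _ _ (by simp [PowerSeries.succPow]) (by simp [PowerSeries.succPow]),
    coeff_eulerSeries]
  congr 1
  funext _ m
  simp [PowerSeries.coeff_mul, PowerSeries.succPow]

theorem gDivisor_pow (j : ℕ) (n : ℕ →₀ ℕ) :
    gDivisor n ^ j = MvPowerSeries.coeff n (eulerSeries (PowerSeries.succPow j)) := by
  rw [gDivisor_eq_prod, coeff_eulerSeries, Finsupp.prod, Finsupp.prod, ← Finset.prod_pow]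
  simp [PowerSeries.succPow]

namespace BeurlingSystem

variable (S : BeurlingSystem)

/-! ### Generalized integers of bounded value -/

theorem p_pos (k : ℕ) : 0 < S.p k := zero_lt_one.trans (S.one_lt_p k)

theorem one_le_val (n : ℕ →₀ ℕ) : 1 ≤ S.val n := by
  rw [val, Finsupp.prod]
  exact Finset.one_le_prod fun i _ => one_le_pow₀ (S.one_lt_p i).le

theorem val_pos (n : ℕ →₀ ℕ) : 0 < S.val n := zero_lt_one.trans_le (S.one_le_val n)

theorem val_add (a b : ℕ →₀ ℕ) : S.val (a + b) = S.val a * S.val b :=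
  Finsupp.prod_add_index' (fun _ => pow_zero _) fun _ _ _ => pow_add _ _ _

theorem pow_le_val (n : ℕ →₀ ℕ) (i : ℕ) : S.p i ^ n i ≤ S.val n := by
  by_cases hi : i ∈ n.support
  · rw [val, Finsupp.prod, ← Finset.mul_prod_erase _ _ hi]
    exact le_mul_of_one_le_right (pow_pos (S.p_pos i) _).le
      (Finset.one_le_prod fun k _ => one_le_pow₀ (S.one_lt_p k).le)
  · rw [Finsupp.notMem_support_iff.1 hi, pow_zero]
    exact S.one_le_val n

theorem finite_val_le (x : ℝ) : {n : ℕ →₀ ℕ | S.val n ≤ x}.Finite := by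
  obtain ⟨R, hR⟩ := (S.p_tendsto.eventually_gt_atTop x).exists_forall_of_atTop
  obtain ⟨M, hM⟩ := pow_unbounded_of_one_lt x (S.one_lt_p 0)
  refine ((Finset.range R).finsupp fun _ => Finset.range M).finite_toSet.subset fun n hn => ?_
  have hn' : ∀ i, S.p i ^ n i ≤ x := fun i => (S.pow_le_val n i).trans hn
  rw [Finset.mem_coe, Finset.mem_finsupp_iff]
  refine ⟨fun i hi => ?_, fun i _ => ?_⟩
  · rw [Finset.mem_range]
    by_contra! h
    have := le_self_pow₀ (S.one_lt_p i).le (Finsupp.mem_support_iff.1 hi)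
    linarith [hR i h, hn' i]
  · rw [Finset.mem_range]
    by_contra! h
    have h1 : S.p 0 ^ M ≤ S.p 0 ^ n i := pow_le_pow_right₀ (S.one_lt_p 0).le h
    have h2 : S.p 0 ^ n i ≤ S.p i ^ n i :=
      pow_le_pow_left₀ (S.p_pos 0).le (S.p_mono (Nat.zero_le i)) _
    linarith [hn' i]

/-- The finite set of generalized integers of value at most `x`. -/
noncomputable def upTo (x : ℝ) : Finset (ℕ →₀ ℕ) := (S.finite_val_le x).toFinset

@[simp] theorem mem_upTo {x : ℝ} {n : ℕ →₀ ℕ} : n ∈ S.upTo x ↔ S.val n ≤ x := by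
  simp [upTo]

theorem upTo_eq_empty {x : ℝ} (hx : x < 1) : S.upTo x = ∅ :=
  Finset.eq_empty_of_forall_notMem fun n hn =>
    absurd ((S.one_le_val n).trans (S.mem_upTo.1 hn)) (not_le.2 hx)

theorem cnt_eq_card (x : ℝ) : S.cnt x = (S.upTo x).card := by
  rw [cnt, ← Set.ncard_coe_finset]
  simp [upTo]

theorem sum_upTo_antidiagonal (F : (ℕ →₀ ℕ) → (ℕ →₀ ℕ) → ℝ) (x : ℝ) :
    ∑ n ∈ S.upTo x, ∑ q ∈ Finset.HasAntidiagonal.antidiagonal n, F q.1 q.2 =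
      ∑ a ∈ S.upTo x, ∑ b ∈ S.upTo (x / S.val a), F a b := by
  rw [Finset.sum_sigma', Finset.sum_sigma']
  refine Finset.sum_nbij' (fun s => ⟨s.2.1, s.2.2⟩) (fun s => ⟨s.1 + s.2, (s.1, s.2)⟩) ?_ ?_ ?_ ?_ ?_
  · rintro ⟨n, a, b⟩ h
    simp only [Finset.mem_sigma, mem_upTo, Finset.HasAntidiagonal.mem_antidiagonal] at h ⊢
    obtain ⟨h1, rfl⟩ := h
    rw [S.val_add] at h1
    refine ⟨(le_mul_of_one_le_right (S.val_pos a).le (S.one_le_val b)).trans h1, ?_⟩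
    rwa [le_div_iff₀' (S.val_pos a)]
  · rintro ⟨a, b⟩ h
    simp only [Finset.mem_sigma, mem_upTo, Finset.HasAntidiagonal.mem_antidiagonal] at h ⊢
    rw [S.val_add, ← le_div_iff₀' (S.val_pos a)]
    exact ⟨h.2, trivial⟩
  · rintro ⟨n, a, b⟩ h
    simp only [Finset.mem_sigma, mem_upTo, Finset.HasAntidiagonal.mem_antidiagonal] at h
    obtain ⟨-, rfl⟩ := h
    rfl
  · rintro ⟨a, b⟩ _
    rfl
  · rintro ⟨n, a, b⟩ _
    rfl

/-- The summatory function of the coefficients of `f`. -/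
noncomputable def partialSum (f : (ℕ →₀ ℕ) → ℝ) (x : ℝ) : ℝ := ∑ n ∈ S.upTo x, f n

theorem partialSum_nonneg {f : (ℕ →₀ ℕ) → ℝ} (hf : ∀ n, 0 ≤ f n) (x : ℝ) :
    0 ≤ S.partialSum f x := Finset.sum_nonneg fun n _ => hf n

/-- Partial summation: the contribution of each `n` to `∫ F'` starts at `t = S.val n`. -/
theorem partialSum_integral (f : (ℕ →₀ ℕ) → ℝ) (F F' : ℝ → ℝ)
    (hF : ∀ t, 1 ≤ t → HasDerivAt F (F' t) t) (hF' : ContinuousOn F' (Set.Ici 1))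
    {x : ℝ} (hx : 1 ≤ x) :
    IntervalIntegrable (fun t => S.partialSum f t * F' t) MeasureTheory.volume 1 x ∧
    ∫ t in (1 : ℝ)..x, S.partialSum f t * F' t =
      ∑ n ∈ S.upTo x, f n * (F x - F (S.val n)) := by
  have hii : ∀ a, 1 ≤ a → a ≤ x → IntervalIntegrable F' MeasureTheory.volume a x := fun a ha hax =>
    (hF'.mono fun t ht => by
      rw [Set.uIcc_of_le hax] at ht; exact ha.trans ht.1).intervalIntegrable
  have hind : ∀ n ∈ S.upTo x, IntervalIntegrable
      (fun t => f n * (Set.Ici (S.val n)).indicator F' t) MeasureTheory.volume 1 x := by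
    intro n _
    have h := hii 1 le_rfl hx
    rw [intervalIntegrable_iff_integrableOn_Ioc_of_le hx] at h ⊢
    exact (h.indicator measurableSet_Ici).const_mul _
  have heq : Set.EqOn (fun t => S.partialSum f t * F' t)
      (fun t => ∑ n ∈ S.upTo x, f n * (Set.Ici (S.val n)).indicator F' t) (Set.uIcc 1 x) := by
    intro t ht
    rw [Set.uIcc_of_le hx] at ht
    have hsub : S.upTo t = (S.upTo x).filter fun n => S.val n ≤ t := by
      ext n
      simp only [mem_upTo, Finset.mem_filter]
      exact ⟨fun h => ⟨h.trans ht.2, h⟩, fun h => h.2⟩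
    simp only [partialSum, hsub, Finset.sum_filter, Finset.sum_mul]
    refine Finset.sum_congr rfl fun n _ => ?_
    by_cases h : S.val n ≤ t
    · simp [Set.indicator, h]
    · simp [Set.indicator, h]
  refine ⟨?_, ?_⟩
  · have h := IntervalIntegrable.sum (S.upTo x) hind
    refine IntervalIntegrable.congr (fun t ht => ?_) h
    rw [Finset.sum_apply]
    exact (heq (Set.uIoc_subset_uIcc ht)).symm
  · rw [intervalIntegral.integral_congr heq, intervalIntegral.integral_finsetSum hind]
    refine Finset.sum_congr rfl fun n hn => ?_
    rw [mem_upTo] at hn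
    have h1 := S.one_le_val n
    rw [intervalIntegral.integral_const_mul]
    congr 1
    rw [← intervalIntegral.integral_eq_sub_of_hasDerivAt (f := F) (f' := F') (a := S.val n) (b := x)
      (fun t ht => hF t (by rw [Set.uIcc_of_le hn] at ht; exact h1.trans ht.1)) (hii _ h1 hn),
      intervalIntegral.integral_of_le hx, intervalIntegral.integral_of_le hn,
      MeasureTheory.setIntegral_indicator measurableSet_Ici,
      ← MeasureTheory.integral_Icc_eq_integral_Ioc (x := S.val n)]
    refine MeasureTheory.setIntegral_congr_set ?_
    have hset : Set.Icc 1 x ∩ Set.Ici (S.val n) = Set.Icc (S.val n) x := by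
      ext t
      simp only [Set.mem_inter_iff, Set.mem_Icc, Set.mem_Ici]
      exact ⟨fun h => ⟨h.2, h.1.2⟩, fun h => ⟨⟨h1.trans h.1, h.2⟩, h.1⟩⟩
    rw [← hset]
    exact MeasureTheory.ae_eq_set_inter MeasureTheory.Ioc_ae_eq_Icc (Filter.EventuallyEq.refl _ _)

end BeurlingSystem

/-! ### Iterated divisor functions -/

/-- The `k`-fold divisor function: the number of ways to write a generalized integer as an ordered
product of `k` factors. -/
noncomputable def foldDivisor (k : ℕ) (n : ℕ →₀ ℕ) : ℝ :=
  MvPowerSeries.coeff n (eulerSeries (PowerSeries.succPow 0 ^ k))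

theorem foldDivisor_one (n : ℕ →₀ ℕ) : foldDivisor 1 n = 1 := by
  simp [foldDivisor, coeff_eulerSeries, PowerSeries.succPow]

theorem PowerSeries.coeff_zero_succPow (j : ℕ) :
    PowerSeries.coeff 0 (PowerSeries.succPow j) = 1 := by
  simp [PowerSeries.succPow]

theorem PowerSeries.coeff_zero_succPow_pow (j k : ℕ) :
    PowerSeries.coeff 0 (PowerSeries.succPow j ^ k) = 1 := by
  rw [PowerSeries.coeff_zero_eq_constantCoeff_apply, map_pow,
    ← PowerSeries.coeff_zero_eq_constantCoeff_apply, PowerSeries.coeff_zero_succPow, one_pow]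

theorem foldDivisor_succ (k : ℕ) (n : ℕ →₀ ℕ) :
    foldDivisor (k + 1) n =
      ∑ q ∈ Finset.HasAntidiagonal.antidiagonal n, foldDivisor k q.1 * foldDivisor 1 q.2 := by
  classical
  rw [foldDivisor, pow_succ, eulerSeries_mul _ _ (PowerSeries.coeff_zero_succPow_pow 0 k)
    (PowerSeries.coeff_zero_succPow 0), MvPowerSeries.coeff_mul]
  simp only [foldDivisor, pow_one]

theorem foldDivisor_nonneg (k : ℕ) (n : ℕ →₀ ℕ) : 0 ≤ foldDivisor k n := by
  induction k generalizing n with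
  | zero =>
    rw [foldDivisor, pow_zero, coeff_eulerSeries, Finsupp.prod]
    refine Finset.prod_nonneg fun i _ => ?_
    rw [PowerSeries.coeff_one]
    split_ifs <;> norm_num
  | succ k ih =>
    rw [foldDivisor_succ]
    exact Finset.sum_nonneg fun q _ => mul_nonneg (ih _) (by rw [foldDivisor_one]; exact zero_le_one)

namespace BeurlingSystem

variable (S : BeurlingSystem)

theorem partialSum_foldDivisor_one (x : ℝ) : S.partialSum (foldDivisor 1) x = S.cnt x := by
  simp [partialSum, foldDivisor_one, cnt_eq_card]

theorem partialSum_foldDivisor_succ (k : ℕ) (x : ℝ) :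
    S.partialSum (foldDivisor (k + 1)) x =
      ∑ a ∈ S.upTo x, foldDivisor k a * S.cnt (x / S.val a) := by
  simp only [← partialSum_foldDivisor_one, partialSum, foldDivisor_succ k, Finset.mul_sum]
  exact S.sum_upTo_antidiagonal (fun a b => foldDivisor k a * foldDivisor 1 b) x

/-- The logarithmic summatory function `∑_{n ≤ x} d_k(n) / n`. -/
noncomputable def logSum (k : ℕ) (x : ℝ) : ℝ := S.partialSum (fun n => foldDivisor k n / S.val n) x

theorem logSum_nonneg (k : ℕ) (x : ℝ) : 0 ≤ S.logSum k x :=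
  S.partialSum_nonneg (fun n => div_nonneg (foldDivisor_nonneg k n) (S.val_pos n).le) x

theorem logSum_succ (k : ℕ) (x : ℝ) :
    S.logSum (k + 1) x =
      ∑ a ∈ S.upTo x, foldDivisor k a / S.val a * S.logSum 1 (x / S.val a) := by
  simp only [logSum, partialSum, Finset.mul_sum]
  rw [← S.sum_upTo_antidiagonal
    (fun a b => foldDivisor k a / S.val a * (foldDivisor 1 b / S.val b)) x]
  refine Finset.sum_congr rfl fun n _ => ?_
  rw [foldDivisor_succ, Finset.sum_div]
  refine Finset.sum_congr rfl fun q hq => ?_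
  rw [← Finset.HasAntidiagonal.mem_antidiagonal.1 hq, S.val_add]
  have := (S.val_pos q.1).ne'
  have := (S.val_pos q.2).ne'
  field_simp

theorem one_le_div_val {x : ℝ} {n : ℕ →₀ ℕ} (h : n ∈ S.upTo x) : 1 ≤ x / S.val n := by
  rw [le_div_iff₀ (S.val_pos n), one_mul]
  exact S.mem_upTo.1 h

variable {S} {A θ K₀ : ℝ}

theorem WellBehaved.cnt_le (h : S.WellBehaved A θ K₀) {x : ℝ} (hx : 1 ≤ x) :
    S.cnt x ≤ (A + K₀) * x := by
  obtain ⟨-, -, hθ1, hK, hN⟩ := h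
  have h1 := (abs_le.1 (hN x hx)).2
  have h2 : x ^ θ ≤ x := by
    simpa using Real.rpow_le_rpow_of_exponent_le hx hθ1.le
  nlinarith [mul_le_mul_of_nonneg_left h2 hK]

theorem WellBehaved.logSum_one (h : S.WellBehaved A θ K₀) :
    ∃ C : ℝ, 0 ≤ C ∧ ∀ x : ℝ, 1 ≤ x → |S.logSum 1 x - A * Real.log x| ≤ C := by
  obtain ⟨hA, hθ0, hθ1, hK, hN⟩ := id h
  have hθ : 0 < 1 - θ := by linarith
  refine ⟨A + K₀ + K₀ / (1 - θ), by positivity, fun x hx => ?_⟩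
  have hx0 : 0 < x := by linarith
  have hcont : ContinuousOn (fun t : ℝ => (t ^ 2)⁻¹) (Set.Ici 1) :=
    (continuousOn_id.pow 2).inv₀ fun t ht => by
      have ht0 : 0 < t := zero_lt_one.trans_le ht
      exact (pow_pos ht0 2).ne'
  obtain ⟨hint, heq⟩ := S.partialSum_integral (foldDivisor 1) (fun t => -t⁻¹) (fun t => (t ^ 2)⁻¹)
    (fun t ht => by simpa using (hasDerivAt_inv (by positivity : t ≠ 0)).fun_neg) hcont hx
  have hsum : ∑ n ∈ S.upTo x, foldDivisor 1 n * (-x⁻¹ - -(S.val n)⁻¹) =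
      S.logSum 1 x - S.cnt x / x := by
    rw [logSum, ← partialSum_foldDivisor_one, partialSum, partialSum, Finset.sum_div,
      ← Finset.sum_sub_distrib]
    refine Finset.sum_congr rfl fun n _ => ?_
    ring
  rw [hsum] at heq
  have hlog : ∫ t in (1 : ℝ)..x, A * t⁻¹ = A * Real.log x := by
    rw [intervalIntegral.integral_const_mul, integral_inv_of_pos one_pos hx0, div_one]
  have hlogint : IntervalIntegrable (fun t : ℝ => A * t⁻¹) MeasureTheory.volume 1 x := by
    refine (intervalIntegral.intervalIntegrable_inv (fun t ht => ?_) continuousOn_id).const_mul A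
    rw [Set.uIcc_of_le hx] at ht
    exact (zero_lt_one.trans_le ht.1).ne'
  have hdiff : S.logSum 1 x - A * Real.log x = S.cnt x / x +
      ∫ t in (1 : ℝ)..x, (S.partialSum (foldDivisor 1) t * (t ^ 2)⁻¹ - A * t⁻¹) := by
    rw [intervalIntegral.integral_sub hint hlogint, heq, hlog]
    ring
  have h0 : (0 : ℝ) ∉ Set.uIcc 1 x := by
    rw [Set.uIcc_of_le hx]
    exact fun h0 => absurd h0.1 (by norm_num)
  have hbound : ‖∫ t in (1 : ℝ)..x, (S.partialSum (foldDivisor 1) t * (t ^ 2)⁻¹ - A * t⁻¹)‖ ≤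
      ∫ t in (1 : ℝ)..x, K₀ * t ^ (θ - 2) := by
    refine intervalIntegral.norm_integral_le_of_norm_le hx (Filter.Eventually.of_forall
      fun t ht => ?_) ((intervalIntegral.intervalIntegrable_rpow (Or.inr h0)).const_mul K₀)
    have ht1 : 1 ≤ t := ht.1.le
    have ht0 : 0 < t := by linarith
    have he : S.partialSum (foldDivisor 1) t * (t ^ 2)⁻¹ - A * t⁻¹ =
        (S.cnt t - A * t) * (t ^ 2)⁻¹ := by
      rw [partialSum_foldDivisor_one]
      field_simp
    rw [he, norm_mul, Real.norm_eq_abs, Real.norm_eq_abs, abs_of_pos (by positivity : 0 < (t ^ 2)⁻¹),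
      Real.rpow_sub ht0, Real.rpow_two, div_eq_mul_inv, ← mul_assoc]
    exact mul_le_mul_of_nonneg_right (hN t ht1) (by positivity)
  rw [intervalIntegral.integral_const_mul, integral_rpow (Or.inr ⟨by linarith, h0⟩),
    Real.one_rpow] at hbound
  have hval : K₀ * ((x ^ (θ - 2 + 1) - 1) / (θ - 2 + 1)) ≤ K₀ / (1 - θ) := by
    have : (x ^ (θ - 2 + 1) - 1) / (θ - 2 + 1) = (1 - x ^ (θ - 2 + 1)) / (1 - θ) := by
      rw [← neg_div_neg_eq]; congr 1 <;> ring
    rw [this, ← mul_div_assoc]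
    refine div_le_div_of_nonneg_right ?_ hθ.le
    have := Real.rpow_nonneg hx0.le (θ - 2 + 1)
    nlinarith
  have hc : |S.cnt x / x| ≤ A + K₀ := by
    have hcnt : 0 ≤ S.cnt x := by rw [cnt_eq_card]; positivity
    rw [abs_of_nonneg (div_nonneg hcnt hx0.le), div_le_iff₀ hx0]
    exact h.cnt_le hx
  rw [hdiff]
  refine (abs_add_le _ _).trans (add_le_add hc (hbound.trans hval))

theorem WellBehaved.logSum_asymp (h : S.WellBehaved A θ K₀) (k : ℕ) :
    ∃ C : ℝ, 0 ≤ C ∧ ∀ x : ℝ, 1 ≤ x →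
      |S.logSum (k + 1) x - A ^ (k + 1) / (k + 1).factorial * Real.log x ^ (k + 1)| ≤
        C * (1 + Real.log x) ^ k := by
  obtain ⟨C₁, hC₁, h₁⟩ := h.logSum_one
  have hA := h.1
  induction k with
  | zero => exact ⟨C₁, hC₁, fun x hx => by simpa using h₁ x hx⟩
  | succ k ih =>
    obtain ⟨C, hC, hk⟩ := ih
    set c : ℝ := A ^ (k + 1) / (k + 1).factorial with hc
    have hc0 : 0 ≤ c := by positivity
    refine ⟨C₁ * (c + C) + A * C, by positivity, fun x hx => ?_⟩
    have hx0 : 0 < x := by linarith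
    have hL := Real.log_nonneg hx
    have hcont : ContinuousOn (fun t : ℝ => t⁻¹) (Set.Ici 1) :=
      continuousOn_id.inv₀ fun t ht => (zero_lt_one.trans_le ht).ne'
    obtain ⟨hint, heq⟩ := S.partialSum_integral (fun n => foldDivisor (k + 1) n / S.val n)
      Real.log (fun t => t⁻¹) (fun t ht => Real.hasDerivAt_log (by positivity)) hcont hx
    set I := ∫ t in (1 : ℝ)..x, S.partialSum (fun n => foldDivisor (k + 1) n / S.val n) t * t⁻¹
    have hpowint : IntervalIntegrable (fun t : ℝ => c * Real.log t ^ (k + 1) * t⁻¹)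
        MeasureTheory.volume 1 x := by
      refine ContinuousOn.intervalIntegrable ?_
      rw [Set.uIcc_of_le hx]
      refine ContinuousOn.mul (continuousOn_const.mul (ContinuousOn.pow ?_ _))
        (hcont.mono fun t ht => ht.1)
      exact Real.continuousOn_log.mono fun t ht => (zero_lt_one.trans_le ht.1).ne'
    have hpow : ∫ t in (1 : ℝ)..x, c * Real.log t ^ (k + 1) * t⁻¹ =
        c / (k + 2) * Real.log x ^ (k + 2) := by
      rw [intervalIntegral.integral_eq_sub_of_hasDerivAt
        (f := fun t => c / (k + 2) * Real.log t ^ (k + 2)) (fun t ht => ?_) hpowint]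
      · simp
      · rw [Set.uIcc_of_le hx] at ht
        have ht0 : t ≠ 0 := (zero_lt_one.trans_le ht.1).ne'
        convert! ((Real.hasDerivAt_log ht0).pow (k + 2)).const_mul (c / (k + 2)) using 1
        push_cast
        have : (k : ℝ) + 2 ≠ 0 := by positivity
        field_simp
    have hconstint : IntervalIntegrable (fun t : ℝ => C * (1 + Real.log x) ^ k * t⁻¹)
        MeasureTheory.volume 1 x := by
      refine ContinuousOn.intervalIntegrable (continuousOn_const.mul (hcont.mono ?_))
      rw [Set.uIcc_of_le hx]
      exact fun t ht => ht.1
    have hI : |I - c / (k + 2) * Real.log x ^ (k + 2)| ≤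
        C * (1 + Real.log x) ^ k * Real.log x := by
      rw [← hpow, ← intervalIntegral.integral_sub hint hpowint]
      have hb := intervalIntegral.norm_integral_le_of_norm_le (μ := MeasureTheory.volume)
        (f := fun t => S.partialSum (fun n => foldDivisor (k + 1) n / S.val n) t * t⁻¹ -
          c * Real.log t ^ (k + 1) * t⁻¹) hx
        (Filter.Eventually.of_forall fun t ht => ?_) hconstint
      · rwa [intervalIntegral.integral_const_mul, integral_inv_of_pos one_pos hx0, div_one] at hb
      · have ht1 : 1 ≤ t := ht.1.le
        have ht0 : 0 < t := by linarith
        have hlt := Real.log_nonneg ht1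
        rw [← sub_mul, norm_mul, Real.norm_eq_abs, Real.norm_eq_abs, abs_of_pos (inv_pos.2 ht0)]
        refine mul_le_mul_of_nonneg_right ((hk t ht1).trans ?_) (inv_pos.2 ht0).le
        have := Real.log_le_log ht0 ht.2
        gcongr
    have hW : |S.logSum (k + 2) x - A * I| ≤ C₁ * S.logSum (k + 1) x := by
      rw [heq, logSum_succ, Finset.mul_sum, ← Finset.sum_sub_distrib, logSum, partialSum,
        Finset.mul_sum]
      refine (Finset.abs_sum_le_sum_abs _ _).trans (Finset.sum_le_sum fun n hn => ?_)
      have hd : 0 ≤ foldDivisor (k + 1) n / S.val n :=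
        div_nonneg (foldDivisor_nonneg _ n) (S.val_pos n).le
      have h2 := h₁ _ (S.one_le_div_val hn)
      rw [Real.log_div hx0.ne' (S.val_pos n).ne'] at h2
      rw [mul_left_comm A, ← mul_sub, abs_mul, abs_of_nonneg hd, mul_comm C₁]
      exact mul_le_mul_of_nonneg_left h2 hd
    have hWle : S.logSum (k + 1) x ≤ (c + C) * (1 + Real.log x) ^ (k + 1) := by
      have h3 := (abs_le.1 (hk x hx)).2
      have h4 : Real.log x ^ (k + 1) ≤ (1 + Real.log x) ^ (k + 1) := by gcongr; linarith
      have h5 : (1 + Real.log x) ^ k ≤ (1 + Real.log x) ^ (k + 1) :=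
        pow_le_pow_right₀ (by linarith) (Nat.le_succ k)
      nlinarith [mul_le_mul_of_nonneg_left h4 hc0, mul_le_mul_of_nonneg_left h5 hC]
    have hcoef : A ^ (k + 1 + 1) / ((k + 1 + 1).factorial : ℝ) = A * (c / (k + 2)) := by
      rw [hc, Nat.factorial_succ (k + 1)]
      push_cast
      have : ((k + 1).factorial : ℝ) ≠ 0 := by positivity
      field_simp
      ring
    rw [hcoef]
    have h6 : |A * I - A * (c / (k + 2)) * Real.log x ^ (k + 2)| ≤
        A * C * (1 + Real.log x) ^ (k + 1) := by
      rw [mul_assoc, ← mul_sub, abs_mul, abs_of_pos hA, mul_assoc]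
      refine mul_le_mul_of_nonneg_left (hI.trans ?_) hA.le
      rw [mul_assoc, pow_succ]
      have : Real.log x ≤ 1 + Real.log x := by linarith
      gcongr
    have h7 : C₁ * S.logSum (k + 1) x ≤ C₁ * (c + C) * (1 + Real.log x) ^ (k + 1) := by
      rw [mul_assoc]
      exact mul_le_mul_of_nonneg_left hWle hC₁
    calc _ ≤ _ := abs_sub_le _ (A * I) _
      _ ≤ _ := add_le_add (hW.trans h7) h6
      _ = _ := by ring

theorem WellBehaved.logSum_le (h : S.WellBehaved A θ K₀) (k : ℕ) :
    ∃ C : ℝ, 0 ≤ C ∧ ∀ x : ℝ, 1 ≤ x → S.logSum (k + 1) x ≤ C * (1 + Real.log x) ^ (k + 1) := by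
  obtain ⟨C, hC, hk⟩ := h.logSum_asymp k
  have hA := h.1
  have hc0 : 0 ≤ A ^ (k + 1) / (k + 1).factorial := by positivity
  refine ⟨A ^ (k + 1) / (k + 1).factorial + C, by positivity, fun x hx => ?_⟩
  have hL := Real.log_nonneg hx
  have h3 := (abs_le.1 (hk x hx)).2
  have h4 : Real.log x ^ (k + 1) ≤ (1 + Real.log x) ^ (k + 1) := by gcongr; linarith
  have h5 : (1 + Real.log x) ^ k ≤ (1 + Real.log x) ^ (k + 1) :=
    pow_le_pow_right₀ (by linarith) (Nat.le_succ k)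
  nlinarith [mul_le_mul_of_nonneg_left h4 hc0, mul_le_mul_of_nonneg_left h5 hC]

theorem WellBehaved.partialSum_foldDivisor_le (h : S.WellBehaved A θ K₀) (k : ℕ) :
    ∃ C : ℝ, 0 ≤ C ∧ ∀ x : ℝ, 1 ≤ x →
      S.partialSum (foldDivisor (k + 1)) x ≤ C * x * (1 + Real.log x) ^ k := by
  have hAK : 0 ≤ A + K₀ := add_nonneg h.1.le h.2.2.2.1
  rcases k with _ | k
  · refine ⟨A + K₀, hAK, fun x hx => ?_⟩
    rw [partialSum_foldDivisor_one, pow_zero, mul_one]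
    exact h.cnt_le hx
  · obtain ⟨C, hC, hk⟩ := h.logSum_le k
    refine ⟨(A + K₀) * C, by positivity, fun x hx => ?_⟩
    have hx0 : 0 < x := by linarith
    calc S.partialSum (foldDivisor (k + 1 + 1)) x
        ≤ (A + K₀) * x * S.logSum (k + 1) x := by
          rw [partialSum_foldDivisor_succ, logSum, partialSum, Finset.mul_sum]
          refine Finset.sum_le_sum fun n hn => ?_
          refine (mul_le_mul_of_nonneg_left (h.cnt_le (S.one_le_div_val hn))
            (foldDivisor_nonneg _ n)).trans_eq ?_
          ring
      _ ≤ (A + K₀) * x * (C * (1 + Real.log x) ^ (k + 1)) :=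
          mul_le_mul_of_nonneg_left (hk x hx) (by positivity)
      _ = _ := by ring

theorem WellBehaved.sum_foldDivisor_rpow_le (h : S.WellBehaved A θ K₀) (k : ℕ) :
    ∃ C : ℝ, 0 ≤ C ∧ ∀ x : ℝ, 1 ≤ x →
      ∑ n ∈ S.upTo x, foldDivisor (k + 1) n * (x / S.val n) ^ θ ≤
        C * x * (1 + Real.log x) ^ k := by
  obtain ⟨C, hC, hT⟩ := h.partialSum_foldDivisor_le k
  obtain ⟨-, hθ0, hθ1, -, -⟩ := id h
  have hθ : 0 < 1 - θ := by linarith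
  refine ⟨C + θ * C / (1 - θ), by positivity, fun x hx => ?_⟩
  have hx0 : 0 < x := by linarith
  have hL := Real.log_nonneg hx
  have hcont : ContinuousOn (fun t : ℝ => θ * t ^ (-θ - 1)) (Set.Ici 1) :=
    continuousOn_const.mul (continuousOn_id.rpow_const fun t ht =>
      Or.inl (zero_lt_one.trans_le ht).ne')
  obtain ⟨hint, heq⟩ := S.partialSum_integral (foldDivisor (k + 1)) (fun t => -t ^ (-θ))
    (fun t => θ * t ^ (-θ - 1)) (fun t ht => by
      simpa using (Real.hasDerivAt_rpow_const (p := -θ) (Or.inl (by positivity : t ≠ 0))).fun_neg)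
    hcont hx
  have hle : ∫ t in (1 : ℝ)..x, S.partialSum (foldDivisor (k + 1)) t * (θ * t ^ (-θ - 1)) ≤
      ∫ t in (1 : ℝ)..x, θ * C * (1 + Real.log x) ^ k * t ^ (-θ) := by
    refine intervalIntegral.integral_mono_on hx hint
      ((intervalIntegral.intervalIntegrable_rpow' (by linarith)).const_mul _) fun t ht => ?_
    have ht0 : 0 < t := zero_lt_one.trans_le ht.1
    have hlt := Real.log_nonneg ht.1
    have hll := Real.log_le_log ht0 ht.2
    have hr : t ^ (-θ) = t * t ^ (-θ - 1) := by
      rw [Real.rpow_sub_one ht0.ne']; field_simp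
    calc S.partialSum (foldDivisor (k + 1)) t * (θ * t ^ (-θ - 1))
        ≤ C * t * (1 + Real.log x) ^ k * (θ * t ^ (-θ - 1)) := by
          refine mul_le_mul_of_nonneg_right ((hT t ht.1).trans ?_) (by positivity)
          gcongr
      _ = _ := by rw [hr]; ring
  rw [intervalIntegral.integral_const_mul, integral_rpow (Or.inl (by linarith)), Real.one_rpow,
    heq] at hle
  have hmul : ∑ n ∈ S.upTo x, foldDivisor (k + 1) n * (x / S.val n) ^ θ =
      S.partialSum (foldDivisor (k + 1)) x + x ^ θ *
        ∑ n ∈ S.upTo x, foldDivisor (k + 1) n * (-x ^ (-θ) - -S.val n ^ (-θ)) := by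
    rw [partialSum, Finset.mul_sum, ← Finset.sum_add_distrib]
    refine Finset.sum_congr rfl fun n _ => ?_
    rw [Real.div_rpow hx0.le (S.val_pos n).le, Real.rpow_neg hx0.le, Real.rpow_neg (S.val_pos n).le]
    have h1 := (Real.rpow_pos_of_pos hx0 θ).ne'
    have h2 := (Real.rpow_pos_of_pos (S.val_pos n) θ).ne'
    field_simp
    ring
  have hfin : x ^ θ * (θ * C * (1 + Real.log x) ^ k * ((x ^ (-θ + 1) - 1) / (-θ + 1))) ≤
      θ * C / (1 - θ) * x * (1 + Real.log x) ^ k := by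
    have hxx : x ^ θ * x ^ (-θ + 1) = x := by
      rw [← Real.rpow_add hx0]; simp
    have hpos := Real.rpow_nonneg hx0.le θ
    have e1 : x ^ θ * (θ * C * (1 + Real.log x) ^ k * ((x ^ (-θ + 1) - 1) / (-θ + 1))) =
        θ * C / (1 - θ) * (1 + Real.log x) ^ k * (x ^ θ * x ^ (-θ + 1) - x ^ θ) := by
      rw [neg_add_eq_sub]; ring
    rw [e1, hxx, mul_right_comm _ x]
    exact mul_le_mul_of_nonneg_left (by linarith) (by positivity)
  rw [hmul]
  have := mul_le_mul_of_nonneg_left hle (Real.rpow_nonneg hx0.le θ)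
  have := hT x hx
  nlinarith

theorem WellBehaved.partialSum_foldDivisor_asymp (h : S.WellBehaved A θ K₀) (k : ℕ) :
    ∃ C : ℝ, 0 ≤ C ∧ ∀ x : ℝ, 1 ≤ x →
      |S.partialSum (foldDivisor (k + 2)) x -
        A ^ (k + 2) / (k + 1).factorial * x * Real.log x ^ (k + 1)| ≤
        C * x * (1 + Real.log x) ^ k := by
  obtain ⟨C₁, hC₁, h₁⟩ := h.logSum_asymp k
  obtain ⟨C₂, hC₂, h₂⟩ := h.sum_foldDivisor_rpow_le k
  obtain ⟨hA, -, -, hK, hN⟩ := id h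
  refine ⟨K₀ * C₂ + A * C₁, by positivity, fun x hx => ?_⟩
  have hx0 : 0 < x := by linarith
  have h3 : |S.partialSum (foldDivisor (k + 2)) x - A * x * S.logSum (k + 1) x| ≤
      K₀ * (C₂ * x * (1 + Real.log x) ^ k) := by
    refine le_trans ?_ (mul_le_mul_of_nonneg_left (h₂ x hx) hK)
    rw [partialSum_foldDivisor_succ, logSum, partialSum, Finset.mul_sum, Finset.mul_sum,
      ← Finset.sum_sub_distrib]
    refine (Finset.abs_sum_le_sum_abs _ _).trans (Finset.sum_le_sum fun n hn => ?_)
    have hd := foldDivisor_nonneg (k + 1) n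
    have e1 : foldDivisor (k + 1) n * S.cnt (x / S.val n) -
        A * x * (foldDivisor (k + 1) n / S.val n) =
        foldDivisor (k + 1) n * (S.cnt (x / S.val n) - A * (x / S.val n)) := by ring
    rw [e1, abs_mul, abs_of_nonneg hd, mul_left_comm]
    exact mul_le_mul_of_nonneg_left (hN _ (S.one_le_div_val hn)) hd
  have h4 : |A * x * S.logSum (k + 1) x -
      A ^ (k + 2) / (k + 1).factorial * x * Real.log x ^ (k + 1)| ≤
      A * x * (C₁ * (1 + Real.log x) ^ k) := by
    have e1 : A * x * S.logSum (k + 1) x -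
        A ^ (k + 2) / (k + 1).factorial * x * Real.log x ^ (k + 1) =
        A * x * (S.logSum (k + 1) x -
          A ^ (k + 1) / (k + 1).factorial * Real.log x ^ (k + 1)) := by ring
    have hAx : 0 ≤ A * x := by positivity
    rw [e1, abs_mul, abs_of_nonneg hAx]
    exact mul_le_mul_of_nonneg_left (h₁ x hx) hAx
  calc _ ≤ _ := abs_sub_le _ (A * x * S.logSum (k + 1) x) _
    _ ≤ _ := add_le_add h3 h4
    _ = _ := by ring

theorem WellBehaved.tendsto_partialSum_foldDivisor (h : S.WellBehaved A θ K₀) (k : ℕ) :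
    Tendsto (fun x => S.partialSum (foldDivisor (k + 2)) x / (x * Real.log x ^ (k + 1))) atTop
      (𝓝 (A ^ (k + 2) / (k + 1).factorial)) := by
  obtain ⟨C, hC, hT⟩ := h.partialSum_foldDivisor_asymp k
  rw [tendsto_iff_norm_sub_tendsto_zero]
  have hlim : Tendsto (fun x => C * 2 ^ k / Real.log x) atTop (𝓝 0) :=
    tendsto_const_nhds.div_atTop Real.tendsto_log_atTop
  refine squeeze_zero' (Filter.Eventually.of_forall fun _ => norm_nonneg _) ?_ hlim
  filter_upwards [Real.tendsto_log_atTop.eventually_ge_atTop 1, eventually_ge_atTop 1] with x hL hx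
  have hx0 : 0 < x := by linarith
  have hL0 : 0 < Real.log x := by linarith
  have hpos : 0 < x * Real.log x ^ (k + 1) := by positivity
  have e1 : S.partialSum (foldDivisor (k + 2)) x / (x * Real.log x ^ (k + 1)) -
      A ^ (k + 2) / (k + 1).factorial = (S.partialSum (foldDivisor (k + 2)) x -
        A ^ (k + 2) / (k + 1).factorial * x * Real.log x ^ (k + 1)) /
          (x * Real.log x ^ (k + 1)) := by
    rw [sub_div, mul_assoc, mul_div_cancel_right₀ _ hpos.ne']
  rw [e1, norm_div, Real.norm_eq_abs, Real.norm_eq_abs, abs_of_pos hpos, div_le_div_iff₀ hpos hL0]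
  calc _ ≤ C * x * (1 + Real.log x) ^ k * Real.log x := by
        exact mul_le_mul_of_nonneg_right (hT x hx) hL0.le
    _ ≤ C * x * (2 * Real.log x) ^ k * Real.log x := by
        gcongr
        linarith
    _ = _ := by rw [mul_pow]; ring

end BeurlingSystem

namespace BeurlingSystem

variable {S : BeurlingSystem} {A θ K₀ : ℝ}

/-! ### Euler products -/

theorem WellBehaved.summable_inv_p_sq (h : S.WellBehaved A θ K₀) :
    Summable fun i => (S.p i)⁻¹ ^ 2 := by
  have hAK : 0 < A + K₀ := add_pos_of_pos_of_nonneg h.1 h.2.2.2.1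
  have hcard : ∀ i : ℕ, (i : ℝ) + 1 ≤ (A + K₀) * S.p i := by
    intro i
    refine le_trans ?_ (h.cnt_le (S.one_lt_p i).le)
    rw [cnt_eq_card]
    have hsub : (Finset.range (i + 1)).map
        ⟨fun k => Finsupp.single k 1, Finsupp.single_left_injective one_ne_zero⟩ ⊆
          S.upTo (S.p i) := by
      intro n hn
      obtain ⟨k, hk, rfl⟩ := Finset.mem_map.1 hn
      have hval : S.val (Finsupp.single k 1) = S.p k := by
        rw [val, Finsupp.prod_single_index (h := fun i e => S.p i ^ e) (pow_zero _), pow_one]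
      rw [mem_upTo, Function.Embedding.coeFn_mk, hval]
      exact S.p_mono (by rw [Finset.mem_range] at hk; omega)
    have hc := Finset.card_le_card hsub
    rw [Finset.card_map, Finset.card_range] at hc
    exact_mod_cast hc
  have hs : Summable fun i : ℕ => (A + K₀) ^ 2 * (1 / ((i + 1 : ℕ) : ℝ) ^ 2) :=
    ((summable_nat_add_iff 1).2
      (Real.summable_one_div_nat_pow.2 one_lt_two)).mul_left ((A + K₀) ^ 2)
  refine Summable.of_nonneg_of_le (fun i => by positivity) (fun i => ?_) hs
  have hp := S.p_pos i
  rw [inv_pow, ← one_div, mul_one_div, div_le_div_iff₀ (by positivity) (by positivity), one_mul,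
    ← mul_pow]
  push_cast
  exact pow_le_pow_left₀ (by positivity) (hcard i) 2

theorem abs_sum_range_mul_pow_sub_one_le {c : ℕ → ℝ} (hc : Summable fun m => |c m|) (h0 : c 0 = 1)
    (h1 : c 1 = 0) {u : ℝ} (hu0 : 0 ≤ u) (hu1 : u ≤ 1) (M : ℕ) :
    |∑ m ∈ Finset.range (M + 2), c m * u ^ m - 1| ≤ (∑' m, |c m|) * u ^ 2 := by
  rw [Finset.sum_range_succ', Finset.sum_range_succ']
  simp only [zero_add, h0, h1, pow_zero, zero_mul, mul_one, add_zero, add_sub_cancel_right]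
  calc |∑ m ∈ Finset.range M, c (m + 1 + 1) * u ^ (m + 1 + 1)|
      ≤ ∑ m ∈ Finset.range M, |c (m + 2)| * u ^ 2 := by
        refine (Finset.abs_sum_le_sum_abs _ _).trans (Finset.sum_le_sum fun m _ => ?_)
        rw [abs_mul, abs_of_nonneg (pow_nonneg hu0 _)]
        exact mul_le_mul_of_nonneg_left (pow_le_pow_of_le_one hu0 hu1 (by omega)) (abs_nonneg _)
    _ = (∑ m ∈ Finset.range M, |c (m + 2)|) * u ^ 2 := by rw [Finset.sum_mul]
    _ ≤ (∑' m, |c m|) * u ^ 2 := by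
        refine mul_le_mul_of_nonneg_right ?_ (sq_nonneg u)
        refine le_trans ?_ (hc.sum_le_tsum (Finset.range (M + 2)) fun _ _ => abs_nonneg _)
        rw [Finset.sum_range_succ', Finset.sum_range_succ']
        have := abs_nonneg (c 0)
        have := abs_nonneg (c (0 + 1))
        linarith

theorem prod_div_val (S : BeurlingSystem) (c : ℕ → ℝ) (n : ℕ →₀ ℕ) :
    (n.prod fun _ m => c m) / S.val n = n.prod fun i m => c m * (S.p i)⁻¹ ^ m := by
  rw [val, Finsupp.prod, Finsupp.prod, Finsupp.prod, ← Finset.prod_div_distrib]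
  exact Finset.prod_congr rfl fun i _ => by rw [inv_pow, div_eq_mul_inv]

theorem inv_p_le_one (S : BeurlingSystem) (i : ℕ) : (S.p i)⁻¹ ≤ 1 :=
  inv_le_one_of_one_le₀ (S.one_lt_p i).le

theorem WellBehaved.summable_prod_div_val (h : S.WellBehaved A θ K₀) {c : ℕ → ℝ}
    (hc : Summable fun m => |c m|) (h0 : c 0 = 1) (h1 : c 1 = 0) :
    Summable fun n : ℕ →₀ ℕ => |n.prod fun _ m => c m| / S.val n := by
  set B := ∑' m, |c m| with hB
  have hB0 : 0 ≤ B := tsum_nonneg fun m => abs_nonneg _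
  have heq : ∀ n : ℕ →₀ ℕ, |n.prod fun _ m => c m| / S.val n =
      n.prod fun i m => |c m| * (S.p i)⁻¹ ^ m := fun n => by
    rw [← prod_div_val S fun m => |c m|, Finsupp.prod, Finsupp.prod, Finset.abs_prod]
  refine summable_of_sum_le (c := Real.exp (∑' i, B * (S.p i)⁻¹ ^ 2))
    (fun n => div_nonneg (abs_nonneg _) (S.val_pos n).le) fun s => ?_
  set R := (s.sup fun n => n.support.sup id) + 1 with hR
  set M := s.sup fun n => n.support.sup n with hM
  have hsub : s ⊆ (Finset.range R).finsupp fun _ => Finset.range (M + 2) := by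
    intro n hn
    rw [Finset.mem_finsupp_iff]
    refine ⟨fun i hi => ?_, fun i _ => ?_⟩
    · have h2 : i ≤ n.support.sup id := Finset.le_sup (f := id) hi
      have h3 : n.support.sup id ≤ s.sup fun n => n.support.sup id :=
        Finset.le_sup (f := fun n : ℕ →₀ ℕ => n.support.sup id) hn
      rw [Finset.mem_range]; omega
    · rw [Finset.mem_range]
      by_cases hi : i ∈ n.support
      · have h2 : n i ≤ n.support.sup n := Finset.le_sup hi
        have h3 : n.support.sup n ≤ M := Finset.le_sup (f := fun n : ℕ →₀ ℕ => n.support.sup n) hn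
        omega
      · rw [Finsupp.notMem_support_iff.1 hi]; omega
  calc ∑ n ∈ s, |n.prod fun _ m => c m| / S.val n
      ≤ ∑ n ∈ (Finset.range R).finsupp fun _ => Finset.range (M + 2),
          |n.prod fun _ m => c m| / S.val n :=
        Finset.sum_le_sum_of_subset_of_nonneg hsub fun n _ _ =>
          div_nonneg (abs_nonneg _) (S.val_pos n).le
    _ = ∏ i ∈ Finset.range R, ∑ m ∈ Finset.range (M + 2), |c m| * (S.p i)⁻¹ ^ m := by
        simp only [heq]
        exact sum_finsupp_prod _ _ (fun i m => |c m| * (S.p i)⁻¹ ^ m) fun i => by simp [h0]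
    _ ≤ ∏ i ∈ Finset.range R, Real.exp (B * (S.p i)⁻¹ ^ 2) := by
        refine Finset.prod_le_prod (fun i _ => Finset.sum_nonneg fun m _ =>
          mul_nonneg (abs_nonneg _) (pow_nonneg (inv_pos.2 (S.p_pos i)).le _)) fun i _ => ?_
        have h2 := (abs_le.1 (abs_sum_range_mul_pow_sub_one_le (c := fun m => |c m|)
          (by simpa using hc) (by simp [h0]) (by simp [h1]) (inv_pos.2 (S.p_pos i)).le
          (S.inv_p_le_one i) M)).2
        simp only [abs_abs] at h2
        have h3 := Real.add_one_le_exp (B * (S.p i)⁻¹ ^ 2)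
        linarith
    _ ≤ Real.exp (∑' i, B * (S.p i)⁻¹ ^ 2) := by
        rw [← Real.exp_sum, Real.exp_le_exp]
        exact (h.summable_inv_p_sq.mul_left B).sum_le_tsum _ fun i _ => by positivity

theorem WellBehaved.tsum_prod_div_val_pos (h : S.WellBehaved A θ K₀) {Q : Polynomial ℝ}
    (h0 : Q.coeff 0 = 1) (h1 : Q.coeff 1 = 0) (hpos : ∀ u : ℝ, 0 ≤ u → u < 1 → 0 < Q.eval u) :
    0 < ∑' n : ℕ →₀ ℕ, (n.prod fun _ m => Q.coeff m) / S.val n := by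
  have hc : Summable fun m => |Q.coeff m| :=
    summable_of_ne_finset_zero (s := Q.support) fun m hm => by
      rw [Polynomial.notMem_support_iff.1 hm, abs_zero]
  set B := ∑' m, |Q.coeff m|
  have hsum : Summable fun n : ℕ →₀ ℕ => (n.prod fun _ m => Q.coeff m) / S.val n := by
    refine Summable.of_norm ?_
    simp only [norm_div, Real.norm_eq_abs, abs_of_pos (S.val_pos _)]
    exact h.summable_prod_div_val hc h0 h1
  have hu0 : ∀ i, 0 < (S.p i)⁻¹ := fun i => inv_pos.2 (S.p_pos i)
  have hQpos : ∀ i, 0 < Q.eval (S.p i)⁻¹ := fun i =>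
    hpos _ (hu0 i).le (inv_lt_one_of_one_lt₀ (S.one_lt_p i))
  have hsub : Summable fun i => Q.eval (S.p i)⁻¹ - 1 := by
    refine Summable.of_norm_bounded (h.summable_inv_p_sq.mul_left B) fun i => ?_
    rw [Polynomial.eval_eq_sum_range' (n := Q.natDegree + 2) (by omega)]
    exact abs_sum_range_mul_pow_sub_one_le hc h0 h1 (hu0 i).le (S.inv_p_le_one i) _
  have hlog : Summable fun i => Real.log (Q.eval (S.p i)⁻¹) := by
    simpa using Real.summable_log_one_add_of_summable hsub
  let s : ℕ → Finset (ℕ →₀ ℕ) := fun R =>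
    (Finset.range R).finsupp fun _ => Finset.range (Q.natDegree + 1 + R)
  have hs : Tendsto s atTop atTop := by
    refine Filter.tendsto_atTop_finset_of_monotone (fun R R' hR n hn => ?_) fun n => ?_
    · rw [Finset.mem_finsupp_iff] at hn ⊢
      refine ⟨hn.1.trans (Finset.range_mono hR), fun i _ => ?_⟩
      rw [Finset.mem_range]
      by_cases hi : i ∈ n.support
      · have := Finset.mem_range.1 (hn.2 i (hn.1 hi)); omega
      · rw [Finsupp.notMem_support_iff.1 hi]; omega
    · refine ⟨n.support.sup id + 1 + n.support.sup n, ?_⟩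
      rw [Finset.mem_finsupp_iff]
      refine ⟨fun i hi => ?_, fun i _ => ?_⟩
      · have h2 : i ≤ n.support.sup id := Finset.le_sup (f := id) hi
        rw [Finset.mem_range]; omega
      · rw [Finset.mem_range]
        by_cases hi : i ∈ n.support
        · have h2 : n i ≤ n.support.sup n := Finset.le_sup hi
          omega
        · rw [Finsupp.notMem_support_iff.1 hi]; omega
  have hlim := hsum.hasSum.comp hs
  have hprod : Tendsto (fun R => ∏ i ∈ Finset.range R, Q.eval (S.p i)⁻¹) atTop
      (𝓝 (Real.exp (∑' i, Real.log (Q.eval (S.p i)⁻¹)))) := by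
    refine ((Real.continuous_exp.tendsto _).comp hlog.hasSum.tendsto_sum_nat).congr fun R => ?_
    rw [Function.comp_apply, Real.exp_sum]
    exact Finset.prod_congr rfl fun i _ => Real.exp_log (hQpos i)
  have heq : ∀ R, ∑ n ∈ s R, (n.prod fun _ m => Q.coeff m) / S.val n =
      ∏ i ∈ Finset.range R, Q.eval (S.p i)⁻¹ := fun R => by
    simp only [prod_div_val S Q.coeff]
    rw [sum_finsupp_prod _ _ (fun i m => Q.coeff m * (S.p i)⁻¹ ^ m) fun i => by simp [h0]]
    exact Finset.prod_congr rfl fun i _ => (Polynomial.eval_eq_sum_range' (by omega) _).symm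
  rw [tendsto_nhds_unique (hlim.congr heq) hprod]
  exact Real.exp_pos _

/-! ### Moments of the divisor function -/

/-- Mean values of a convolution of an absolutely convergent factor with a fold divisor function. -/
theorem WellBehaved.tendsto_partialSum_mul (h : S.WellBehaved A θ K₀) (k : ℕ)
    {g f : (ℕ →₀ ℕ) → ℝ} (hg : Summable fun n => |g n| / S.val n)
    (hf : ∀ n, f n = ∑ q ∈ Finset.HasAntidiagonal.antidiagonal n,
      g q.1 * foldDivisor (k + 2) q.2) :
    Tendsto (fun x => S.partialSum f x / (x * Real.log x ^ (k + 1))) atTop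
      (𝓝 (∑' n, g n / S.val n * (A ^ (k + 2) / (k + 1).factorial))) := by
  obtain ⟨C, hC, hT⟩ := h.partialSum_foldDivisor_le (k + 1)
  have hzero : ∀ x n, x < S.val n → S.partialSum (foldDivisor (k + 2)) (x / S.val n) = 0 := by
    intro x n hx
    rw [partialSum, S.upTo_eq_empty ((div_lt_one (S.val_pos n)).2 hx), Finset.sum_empty]
  have hconv : ∀ x, S.partialSum f x / (x * Real.log x ^ (k + 1)) =
      ∑' n, g n * (S.partialSum (foldDivisor (k + 2)) (x / S.val n) /
        (x * Real.log x ^ (k + 1))) := by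
    intro x
    rw [tsum_eq_sum (s := S.upTo x) fun n hn => ?_]
    · simp only [partialSum, hf]
      rw [S.sum_upTo_antidiagonal (fun a b => g a * foldDivisor (k + 2) b), Finset.sum_div]
      refine Finset.sum_congr rfl fun a _ => ?_
      rw [← Finset.mul_sum, mul_div_assoc]
    · rw [mem_upTo, not_le] at hn
      rw [hzero x n hn, zero_div, mul_zero]
  simp only [hconv]
  refine tendsto_tsum_of_dominated_convergence
    (bound := fun n => |g n| / S.val n * (C * 2 ^ (k + 1))) (hg.mul_right _) (fun n => ?_) ?_
  · have hv := S.val_pos n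
    have hlogdiv : Tendsto (fun x => Real.log (x / S.val n) / Real.log x) atTop (𝓝 1) := by
      have h2 : Tendsto (fun x => 1 - Real.log (S.val n) / Real.log x) atTop (𝓝 (1 - 0)) :=
        tendsto_const_nhds.sub (tendsto_const_nhds.div_atTop Real.tendsto_log_atTop)
      rw [sub_zero] at h2
      refine h2.congr' ?_
      filter_upwards [eventually_gt_atTop 1] with x hx
      have hL := (Real.log_pos hx).ne'
      rw [Real.log_div (by positivity) hv.ne', sub_div, div_self hL]
    have hmain := ((h.tendsto_partialSum_foldDivisor k).comp
      (tendsto_id.atTop_div_const hv)).mul (hlogdiv.pow (k + 1))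
    rw [one_pow, mul_one] at hmain
    have h3 := hmain.const_mul (g n / S.val n)
    refine h3.congr' ?_
    filter_upwards [eventually_gt_atTop 1, eventually_gt_atTop (S.val n)] with x hx hxv
    have hL := (Real.log_pos hx).ne'
    have hL' : Real.log (x / S.val n) ≠ 0 := (Real.log_pos ((one_lt_div hv).2 hxv)).ne'
    have hx0 : x ≠ 0 := by positivity
    have hv' := hv.ne'
    simp only [Function.comp_apply, id]
    rw [div_pow]
    field_simp
  · filter_upwards [Real.tendsto_log_atTop.eventually_ge_atTop 1, eventually_ge_atTop 1]
      with x hL hx n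
    have hx0 : 0 < x := by linarith
    have hL0 : 0 < Real.log x := by linarith
    have hv := S.val_pos n
    have hpos : 0 < x * Real.log x ^ (k + 1) := by positivity
    rw [norm_mul, Real.norm_eq_abs, div_mul_eq_mul_div, mul_div_assoc]
    refine mul_le_mul_of_nonneg_left ?_ (abs_nonneg _)
    rw [Real.norm_eq_abs, abs_of_nonneg
      (div_nonneg (S.partialSum_nonneg (foldDivisor_nonneg _) _) hpos.le), div_le_iff₀ hpos]
    rcases lt_or_ge x (S.val n) with hlt | hge
    · rw [hzero x n hlt]
      positivity
    · have h1 : 1 ≤ x / S.val n := (one_le_div hv).2 hge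
      have h2 : Real.log (x / S.val n) ≤ Real.log x :=
        Real.log_le_log (by positivity) (div_le_self hx0.le (S.one_le_val n))
      have h3 := Real.log_nonneg h1
      calc _ ≤ C * (x / S.val n) * (1 + Real.log (x / S.val n)) ^ (k + 1) := hT _ h1
        _ ≤ C * (x / S.val n) * (2 * Real.log x) ^ (k + 1) := by
          gcongr
          linarith
        _ = _ := by rw [mul_pow]; ring

end BeurlingSystem

/-- **Mean values of powers of the generalized divisor function** (Knopfmacher,
Lemma 3.4). For a well-behaved Beurling system and each positive integer `j`,
there is `c_j > 0` with `∑_{n_k ≤ x} d(n_k)^j ∼ c_j x (log x)^{2^j - 1}`. -/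
theorem beurling_divisor_moments
    (S : BeurlingSystem) (A θ K₀ : ℝ) (hWB : S.WellBehaved A θ K₀) :
    ∀ j : ℕ, 0 < j →
      ∃ c : ℝ, 0 < c ∧
        Filter.Tendsto
          (fun x : ℝ =>
            (∑ᶠ n ∈ {n : ℕ →₀ ℕ | S.val n ≤ x}, gDivisor n ^ j)
              / (c * x * Real.log x ^ (2 ^ j - 1)))
          Filter.atTop (nhds 1) := by
  intro j hj
  classical
  obtain ⟨Q, h0, h1, hpos, hQ⟩ := PowerSeries.exists_quotient_polynomial j
  obtain ⟨k, hk⟩ : ∃ k, 2 ^ j = k + 2 :=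
    ⟨2 ^ j - 2, by have := Nat.pow_le_pow_right two_pos hj; omega⟩
  have hc : Summable fun m => |Q.coeff m| :=
    summable_of_ne_finset_zero (s := Q.support) fun m hm => by
      rw [Polynomial.notMem_support_iff.1 hm, abs_zero]
  have hconv : ∀ n, gDivisor n ^ j = ∑ q ∈ Finset.HasAntidiagonal.antidiagonal n,
      (q.1.prod fun _ m => Q.coeff m) * foldDivisor (k + 2) q.2 := by
    intro n
    rw [gDivisor_pow, hQ, hk, eulerSeries_mul _ _ (by rw [Polynomial.coeff_coe, h0])
      (PowerSeries.coeff_zero_succPow_pow 0 _), MvPowerSeries.coeff_mul]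
    simp only [foldDivisor, coeff_eulerSeries, Polynomial.coeff_coe]
  have hlim := hWB.tendsto_partialSum_mul k (hWB.summable_prod_div_val hc h0 h1) hconv
  rw [tsum_mul_right] at hlim
  have hA := hWB.1
  have hcpos : 0 < (∑' n : ℕ →₀ ℕ, (n.prod fun _ m => Q.coeff m) / S.val n) *
      (A ^ (k + 2) / (k + 1).factorial) :=
    mul_pos (hWB.tsum_prod_div_val_pos h0 h1 hpos) (by positivity)
  refine ⟨_, hcpos, ?_⟩
  have h2 := hlim.div_const ((∑' n : ℕ →₀ ℕ, (n.prod fun _ m => Q.coeff m) / S.val n) *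
      (A ^ (k + 2) / (k + 1).factorial))
  rw [div_self hcpos.ne'] at h2
  refine h2.congr fun x => ?_
  rw [finsum_mem_eq_finite_toFinset_sum _ (S.finite_val_le x), hk, div_div, mul_assoc _ x,
    mul_comm (x * _)]
  rfl
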